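/- Let λ : ℝ → [0,∞) be measurable with Leb{x : λ(x) = 0} = 0 and 1/λ locally Lebesgue integrable, and suppose there exist a_+, a_− > 0 and δ > −1 such that lim_{x→∞} x^{−(1+δ)} ∫_0^x ds/λ(s) = 1/a_+ and lim_{x→∞} x^{−(1+δ)} ∫_{−x}^0 ds/λ(s) = 1/a_−. Define φ_n(u) = n^{−(1+δ)/(2+δ)} ∫_0^{u·n^{1/(2+δ)}} dv/λ(v) for u ∈ ℝ (with the sign convention ∫_0^a = −∫_a^0 for a < 0). Then there exist a constant A > 0 and an index N such that for all n ≥ N and all u ∈ ℝ, |φ_n(u)| ≤ A(1 + |u|^{1+δ}). -/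

import Mathlib

open MeasureTheory Filter Set
open scoped Topology

/-- A function that is monotone on `[0, ∞)` and asymptotically of order at most `x ^ p` is
globally bounded by a multiple of `1 + x ^ p`. -/
theorem exists_le_mul_one_add_rpow_of_monotoneOn {G : ℝ → ℝ} {p c : ℝ}
    (hG : MonotoneOn G (Ici 0))
    (hlim : Tendsto (fun x : ℝ => x ^ (-p) * G x) atTop (𝓝 c)) :
    ∃ C : ℝ, 0 < C ∧ ∀ x : ℝ, 0 ≤ x → G x ≤ C * (1 + x ^ p) := by
  obtain ⟨M, hM⟩ := eventually_atTop.1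
    ((hlim.eventually (gt_mem_nhds (lt_add_one c))).and (eventually_ge_atTop 1))
  have hM0 : 0 ≤ M := zero_le_one.trans (hM M le_rfl).2
  refine ⟨|c + 1| + |G M| + 1, by positivity, fun x hx => ?_⟩
  have hxp : 0 ≤ x ^ p := Real.rpow_nonneg hx p
  have hK := abs_nonneg (c + 1)
  have hGM := abs_nonneg (G M)
  rcases le_total M x with h | h
  · obtain ⟨hlt, hx1⟩ := hM x h
    have hx0 : 0 < x := zero_lt_one.trans_le hx1
    have hpos : 0 < x ^ p := Real.rpow_pos_of_pos hx0 p
    rw [Real.rpow_neg hx, inv_mul_lt_iff₀ hpos] at hlt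
    nlinarith [le_abs_self (c + 1), mul_le_mul_of_nonneg_left (le_abs_self (c + 1)) hxp,
      mul_nonneg hGM hxp]
  · have hle := hG (mem_Ici.2 hx) (mem_Ici.2 hM0) h
    nlinarith [le_abs_self (G M), mul_nonneg hGM hxp, mul_nonneg hK hxp]

/-- If the primitive of a nonnegative locally integrable function is asymptotic to multiples of
`|x| ^ p` at both ends, then it is globally bounded by a multiple of `1 + |x| ^ p`. -/
theorem exists_abs_integral_le_mul_one_add_rpow {f : ℝ → ℝ} (hf : ∀ x, 0 ≤ f x)
    (hint : LocallyIntegrable f volume) {p c d : ℝ}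
    (hlimP : Tendsto (fun x : ℝ => x ^ (-p) * ∫ s in (0:ℝ)..x, f s) atTop (𝓝 c))
    (hlimM : Tendsto (fun x : ℝ => x ^ (-p) * ∫ s in (-x)..(0:ℝ), f s) atTop (𝓝 d)) :
    ∃ C : ℝ, 0 < C ∧ ∀ x : ℝ, |∫ s in (0:ℝ)..x, f s| ≤ C * (1 + |x| ^ p) := by
  have hii : ∀ a b : ℝ, IntervalIntegrable f volume a b := fun a b =>
    (hint.integrableOn_isCompact isCompact_uIcc).intervalIntegrable
  have hf0 : ∀ μ : Measure ℝ, 0 ≤ᵐ[μ] f := fun μ => Eventually.of_forall hf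
  have hmonoP : MonotoneOn (fun x : ℝ => ∫ s in (0:ℝ)..x, f s) (Ici 0) := fun x hx y _ hxy =>
    intervalIntegral.integral_mono_interval le_rfl hx hxy (hf0 _) (hii _ _)
  have hmonoM : MonotoneOn (fun x : ℝ => ∫ s in (-x)..(0:ℝ), f s) (Ici 0) := fun x hx y _ hxy =>
    intervalIntegral.integral_mono_interval (neg_le_neg hxy) (neg_nonpos.2 hx) le_rfl
      (hf0 _) (hii _ _)
  obtain ⟨C, hC, hCle⟩ := exists_le_mul_one_add_rpow_of_monotoneOn hmonoP hlimP
  obtain ⟨D, hD, hDle⟩ := exists_le_mul_one_add_rpow_of_monotoneOn hmonoM hlimM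
  refine ⟨max C D, lt_max_of_lt_left hC, fun x => ?_⟩
  have hpos : 0 ≤ 1 + |x| ^ p := by positivity
  rcases le_total 0 x with hx | hx
  · rw [abs_of_nonneg (intervalIntegral.integral_nonneg hx fun s _ => hf s)]
    have h := hCle x hx
    rw [abs_of_nonneg hx] at hpos ⊢
    exact h.trans (mul_le_mul_of_nonneg_right (le_max_left C D) hpos)
  · rw [intervalIntegral.integral_symm, abs_neg,
      abs_of_nonneg (intervalIntegral.integral_nonneg hx fun s _ => hf s)]
    have h := hDle (-x) (neg_nonneg.2 hx)
    rw [neg_neg, ← abs_of_nonpos hx] at h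
    exact h.trans (mul_le_mul_of_nonneg_right (le_max_right C D) hpos)

/-- Uniform bound on the normalized primitives
`φ_n(u) = n^{-(1+δ)/(2+δ)} ∫_0^{u n^{1/(2+δ)}} dv/λ(v)`: there are `A > 0` and `N` such
that `|φ_n(u)| ≤ A (1 + |u|^{1+δ})` for all `n ≥ N` and all `u ∈ ℝ`. -/
theorem phi_uniform_bound
    (lam : ℝ → ℝ) (hlam_meas : Measurable lam) (hlam_nonneg : ∀ x, 0 ≤ lam x)
    (hlam_ae : volume {x : ℝ | lam x = 0} = 0)
    (hlam_loc : LocallyIntegrable (fun x => (lam x)⁻¹) volume)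
    (δ : ℝ) (hδ : -1 < δ)
    (aP aM : ℝ) (haP : 0 < aP) (haM : 0 < aM)
    (hlimP : Tendsto (fun x : ℝ => x ^ (-(1 + δ)) * ∫ s in (0:ℝ)..x, (lam s)⁻¹)
      atTop (𝓝 aP⁻¹))
    (hlimM : Tendsto (fun x : ℝ => x ^ (-(1 + δ)) * ∫ s in (-x)..(0:ℝ), (lam s)⁻¹)
      atTop (𝓝 aM⁻¹))
    (φ : ℕ → ℝ → ℝ)
    (hφ : ∀ (n : ℕ) (u : ℝ), φ n u =
      (n : ℝ) ^ (-((1 + δ) / (2 + δ))) *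
        ∫ v in (0:ℝ)..(u * (n : ℝ) ^ ((1 : ℝ) / (2 + δ))), (lam v)⁻¹)
 :
    ∃ A : ℝ, 0 < A ∧ ∃ N : ℕ, ∀ n : ℕ, N ≤ n → ∀ u : ℝ,
      |φ n u| ≤ A * (1 + |u| ^ (1 + δ)) := by
  obtain ⟨C, hC, hCle⟩ := exists_abs_integral_le_mul_one_add_rpow
    (fun x => inv_nonneg.2 (hlam_nonneg x)) hlam_loc hlimP hlimM
  refine ⟨C, hC, 1, fun n hn u => ?_⟩
  have hn1 : (1 : ℝ) ≤ n := by exact_mod_cast hn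
  have hn0 : (0 : ℝ) < n := zero_lt_one.trans_le hn1
  have hexp : 0 ≤ (1 + δ) / (2 + δ) := div_nonneg (by linarith) (by linarith)
  set q : ℝ := (n : ℝ) ^ ((1 + δ) / (2 + δ)) with hq
  have hq1 : 1 ≤ q := Real.one_le_rpow hn1 hexp
  have hq0 : 0 < q := zero_lt_one.trans_le hq1
  have hscale : |u * (n : ℝ) ^ ((1 : ℝ) / (2 + δ))| ^ (1 + δ) = |u| ^ (1 + δ) * q := by
    rw [abs_mul, abs_of_pos (Real.rpow_pos_of_pos hn0 _),
      Real.mul_rpow (abs_nonneg u) (Real.rpow_nonneg hn0.le _), ← Real.rpow_mul hn0.le, hq,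
      one_div_mul_eq_div]
  rw [hφ, Real.rpow_neg hn0.le, ← hq, abs_mul, abs_of_pos (inv_pos.2 hq0), inv_mul_le_iff₀ hq0]
  refine (hCle _).trans ?_
  rw [hscale]
  nlinarith [mul_le_mul_of_nonneg_left hq1 hC.le]
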